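/- arXiv:math/0510664 — 5 statements merged into one kernel-verified Lean document; each statement's English description precedes it below -/
import Mathlib

section
/- Let (A, C, ι, ι*) be a knowledgeable Frobenius algebra over a field k. Then ι* : A → C is a homomorphism of coalgebras: ε_C ∘ ι* = ε_A, and Δ_C(ι*(a)) = (ι* ⊗ ι*)(Δ_A(a)) for all a ∈ A. -/
open TensorProduct

/-- A Frobenius algebra over a field `k`. -/
structure FrobeniusData (k A : Type*) [Field k] [Ring A] [Algebra k A] where
  Δ : A →ₗ[k] A ⊗[k] A
  ε : A →ₗ[k] k
  coassoc : ∀ a : A,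
    (TensorProduct.assoc k A A A) (Δ.rTensor A (Δ a)) = Δ.lTensor A (Δ a)
  counit_left : ∀ a : A, (TensorProduct.lid k A) (ε.rTensor A (Δ a)) = a
  counit_right : ∀ a : A, (TensorProduct.rid k A) (ε.lTensor A (Δ a)) = a
  frob_left : ∀ a b : A, Δ (a * b) = Δ a * ((1 : A) ⊗ₜ[k] b)
  frob_right : ∀ a b : A, Δ (a * b) = (a ⊗ₜ[k] (1 : A)) * Δ b

/-- A knowledgeable Frobenius algebra over a field `k`: a symmetric Frobenius
algebra `A`, a commutative Frobenius algebra `C`, an algebra homomorphism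
`ι : C → A` and a linear map `ιStar : A → C` satisfying the knowledge,
duality and Cardy conditions. -/
structure KnowledgeableFrobenius (k A C : Type*) [Field k]
    [Ring A] [Algebra k A] [CommRing C] [Algebra k C] where
  FA : FrobeniusData k A
  FC : FrobeniusData k C
  symmA : ∀ a b : A, FA.ε (a * b) = FA.ε (b * a)
  ι : C →ₐ[k] A
  ιStar : A →ₗ[k] C
  knowledge : ∀ (a : A) (c : C), ι c * a = a * ι c
  duality : ∀ (a : A) (c : C), FC.ε (c * ιStar a) = FA.ε (ι c * a)
  cardy : ∀ a : A,
    ι (ιStar a) = LinearMap.mul' k A ((TensorProduct.comm k A A) (FA.Δ a))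

namespace FrobeniusData

variable {k A : Type*} [Field k] [Ring A] [Algebra k A] (F : FrobeniusData k A)

/-- The functional `ε ⊗ ε` on `A ⊗ A`, with values in `k`. -/
noncomputable def counitTensor : A ⊗[k] A →ₗ[k] k :=
  LinearMap.mul' k k ∘ₗ TensorProduct.map F.ε F.ε

@[simp]
theorem counitTensor_tmul (a b : A) : F.counitTensor (a ⊗ₜ[k] b) = F.ε a * F.ε b := by
  simp [counitTensor]

/-- The comultiplication is adjoint to the opposite multiplication. -/
theorem counitTensor_tmul_mul_comul (x y a : A) :
    F.counitTensor ((x ⊗ₜ[k] y) * F.Δ a) = F.ε (y * (x * a)) := by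
  have slice (t : A ⊗[k] A) : F.counitTensor (((1 : A) ⊗ₜ[k] y) * t) =
      F.ε (y * TensorProduct.lid k A (F.ε.rTensor A t)) := by
    induction t with
    | zero => simp
    | tmul u v => simp
    | add u v hu hv => simp only [mul_add, map_add, hu, hv]
  have h : (x ⊗ₜ[k] y) * F.Δ a = ((1 : A) ⊗ₜ[k] y) * F.Δ (x * a) := by
    rw [F.frob_right, ← mul_assoc]
    simp
  rw [h, slice, F.counit_left]

/-- The components of `Δ 1` form a pair of dual families for the Frobenius form. -/
theorem exists_dual_families : ∃ s : Finset (A × A),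
    ∀ a : A, a = ∑ i ∈ s, F.ε (a * i.1) • i.2 := by
  obtain ⟨s, hs⟩ := TensorProduct.exists_finset (F.Δ 1)
  refine ⟨s, fun a => ?_⟩
  have h := F.counit_left (a * 1)
  rw [F.frob_right, hs] at h
  simpa [Finset.mul_sum] using h.symm

/-- The form induced by `ε ⊗ ε` on `A ⊗ A` is nondegenerate. -/
theorem tensor_ext {s t : A ⊗[k] A}
    (h : ∀ x y : A, F.counitTensor (s * (x ⊗ₜ[k] y)) = F.counitTensor (t * (x ⊗ₜ[k] y))) :
    s = t := by
  obtain ⟨e, he⟩ := F.exists_dual_families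
  have expand (u : A ⊗[k] A) : u = ∑ i ∈ e, ∑ j ∈ e,
      F.counitTensor (u * (i.1 ⊗ₜ[k] j.1)) • (i.2 ⊗ₜ[k] j.2) := by
    induction u with
    | zero => simp
    | tmul a b =>
      conv_lhs => rw [he a, he b]
      rw [TensorProduct.sum_tmul]
      simp only [TensorProduct.tmul_sum, TensorProduct.smul_tmul_smul,
        Algebra.TensorProduct.tmul_mul_tmul, counitTensor_tmul]
    | add u v hu hv =>
      simp only [add_mul, map_add, add_smul, Finset.sum_add_distrib]
      rw [← hu, ← hv]
  rw [expand s, expand t]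
  simp only [h]

end FrobeniusData

/-- The maps `ιStar ⊗ ιStar` and `ι ⊗ ι` are adjoint for the forms induced by the counits. -/
theorem KnowledgeableFrobenius.counitTensor_mul_map_ιStar {k A C : Type*} [Field k]
    [Ring A] [Algebra k A] [CommRing C] [Algebra k C] (K : KnowledgeableFrobenius k A C)
    (c d : C) (t : A ⊗[k] A) :
    K.FC.counitTensor ((c ⊗ₜ[k] d) * TensorProduct.map K.ιStar K.ιStar t) =
      K.FA.counitTensor ((K.ι c ⊗ₜ[k] K.ι d) * t) := by
  induction t with
  | zero => simp
  | tmul a b => simp [K.duality]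
  | add u v hu hv => simp only [mul_add, map_add, hu, hv]

/-- In a knowledgeable Frobenius algebra, `ιStar : A → C` is a homomorphism of
coalgebras: it intertwines the counits and the comultiplications. -/
theorem iotaStar_coalgebraHom
    (k A C : Type*) [Field k] [Ring A] [Algebra k A] [CommRing C] [Algebra k C]
    (K : KnowledgeableFrobenius k A C) :
    (∀ a : A, K.FC.ε (K.ιStar a) = K.FA.ε a) ∧
    (∀ a : A, K.FC.Δ (K.ιStar a) =
      TensorProduct.map K.ιStar K.ιStar (K.FA.Δ a)) := by
  refine ⟨fun a => by simpa using K.duality a 1, fun a => K.FC.tensor_ext fun c d => ?_⟩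
  rw [mul_comm, mul_comm (TensorProduct.map _ _ _), K.counitTensor_mul_map_ιStar,
    K.FC.counitTensor_tmul_mul_comul, K.FA.counitTensor_tmul_mul_comul,
    ← mul_assoc, K.duality, map_mul K.ι, mul_assoc]
end

section
/- Let (A, C, ι, ι*) be a knowledgeable Frobenius algebra over a field k. Then, as elements of A ⊗[k] C and C ⊗[k] A respectively: (id_A ⊗ ι*)(Δ_A(1_A)) = (ι ⊗ id_C)(Δ_C(1_C)) and (ι* ⊗ id_A)(Δ_A(1_A)) = (id_C ⊗ ι)(Δ_C(1_C)). -/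
open TensorProduct

namespace FrobeniusData

variable {k A : Type*} [Field k] [Ring A] [Algebra k A] (F : FrobeniusData k A)

theorem sum_counit_mul_fst_smul_snd {S : Finset (A × A)}
    (hS : F.Δ 1 = ∑ p ∈ S, p.1 ⊗ₜ[k] p.2) (a : A) :
    ∑ p ∈ S, F.ε (a * p.1) • p.2 = a := by
  have h := F.counit_left (a * 1)
  rw [F.frob_right, hS] at h
  simpa [Finset.mul_sum] using h

theorem sum_counit_snd_mul_smul_fst {S : Finset (A × A)}
    (hS : F.Δ 1 = ∑ p ∈ S, p.1 ⊗ₜ[k] p.2) (a : A) :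
    ∑ p ∈ S, F.ε (p.2 * a) • p.1 = a := by
  have h := F.counit_right (1 * a)
  rw [F.frob_left, hS] at h
  simpa [Finset.sum_mul] using h

end FrobeniusData

namespace KnowledgeableFrobenius

variable {k A C : Type*} [Field k] [Ring A] [Algebra k A] [CommRing C] [Algebra k C]
  (K : KnowledgeableFrobenius k A C)

theorem ιStar_eq_sum_smul_snd {T : Finset (C × C)}
    (hT : K.FC.Δ 1 = ∑ q ∈ T, q.1 ⊗ₜ[k] q.2) (a : A) :
    K.ιStar a = ∑ q ∈ T, K.FA.ε (K.ι q.1 * a) • q.2 := by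
  rw [← K.FC.sum_counit_mul_fst_smul_snd hT (K.ιStar a)]
  simp only [mul_comm (K.ιStar a), K.duality]

theorem ιStar_eq_sum_smul_fst {T : Finset (C × C)}
    (hT : K.FC.Δ 1 = ∑ q ∈ T, q.1 ⊗ₜ[k] q.2) (a : A) :
    K.ιStar a = ∑ q ∈ T, K.FA.ε (K.ι q.2 * a) • q.1 := by
  rw [← K.FC.sum_counit_snd_mul_smul_fst hT (K.ιStar a)]
  simp only [K.duality]

end KnowledgeableFrobenius

/-- In a knowledgeable Frobenius algebra,
`(id_A ⊗ ιStar) (Δ_A 1) = (ι ⊗ id_C) (Δ_C 1)` in `A ⊗[k] C` and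
`(ιStar ⊗ id_A) (Δ_A 1) = (id_C ⊗ ι) (Δ_C 1)` in `C ⊗[k] A`. -/
theorem copairing_compatibility
    (k A C : Type*) [Field k] [Ring A] [Algebra k A] [CommRing C] [Algebra k C]
    (K : KnowledgeableFrobenius k A C) :
    K.ιStar.lTensor A (K.FA.Δ 1) =
      TensorProduct.map K.ι.toLinearMap LinearMap.id (K.FC.Δ 1) ∧
    K.ιStar.rTensor A (K.FA.Δ 1) =
      TensorProduct.map LinearMap.id K.ι.toLinearMap (K.FC.Δ 1) := by
  obtain ⟨S, hS⟩ := TensorProduct.exists_finset (K.FA.Δ 1)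
  obtain ⟨T, hT⟩ := TensorProduct.exists_finset (K.FC.Δ 1)
  rw [hS, hT]
  simp only [map_sum, LinearMap.lTensor_tmul, LinearMap.rTensor_tmul, TensorProduct.map_tmul,
    LinearMap.id_apply, AlgHom.toLinearMap_apply]
  constructor
  · simp_rw [K.ιStar_eq_sum_smul_snd hT, TensorProduct.tmul_sum]
    rw [Finset.sum_comm]
    refine Finset.sum_congr rfl fun q _ => ?_
    conv_rhs => rw [← K.FA.sum_counit_snd_mul_smul_fst hS (K.ι q.1), TensorProduct.sum_tmul]
    simp only [K.symmA (K.ι q.1), TensorProduct.smul_tmul]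
  · simp_rw [K.ιStar_eq_sum_smul_fst hT, TensorProduct.sum_tmul]
    rw [Finset.sum_comm]
    refine Finset.sum_congr rfl fun q _ => ?_
    conv_rhs => rw [← K.FA.sum_counit_mul_fst_smul_snd hS (K.ι q.2), TensorProduct.tmul_sum]
    simp only [TensorProduct.smul_tmul]
end

section
/- Let (A, C, ι, ι*) be a knowledgeable Frobenius algebra over a field k. Define the closed window W := ι* ∘ ι : C → C and the genus-one operator H := m_C ∘ Δ_C : C → C, where m_C is the multiplication of C. Then for all c, c' ∈ C: W(c*c') = W(c)*c' = c*W(c'); Δ_C(W(c)) = (W ⊗ id_C)(Δ_C(c)) = (id_C ⊗ W)(Δ_C(c)); and W(H(c)) = H(W(c)). -/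
open TensorProduct

/-- The form `(a, b) ↦ ε (a * b)` of a Frobenius algebra is nondegenerate. -/
theorem FrobeniusData.ext_of_counit_mul {k A : Type*} [Field k] [Ring A] [Algebra k A]
    (F : FrobeniusData k A) {x y : A} (h : ∀ a, F.ε (a * x) = F.ε (a * y)) : x = y := by
  have key (t : A ⊗[k] A) :
      F.ε.lTensor A (t * ((1 : A) ⊗ₜ[k] x)) = F.ε.lTensor A (t * ((1 : A) ⊗ₜ[k] y)) := by
    induction t with
    | zero => simp
    | tmul a b => simp [h]
    | add s t hs ht => simp only [add_mul, map_add, hs, ht]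
  rw [← F.counit_right x, ← F.counit_right y, ← one_mul x, ← one_mul y, F.frob_left,
    F.frob_left, key]

/-- The map `ιStar` is `C`-linear. -/
theorem KnowledgeableFrobenius.ιStar_ι_mul {k A C : Type*} [Field k] [Ring A] [Algebra k A]
    [CommRing C] [Algebra k C] (K : KnowledgeableFrobenius k A C) (c : C) (a : A) :
    K.ιStar (K.ι c * a) = c * K.ιStar a :=
  K.FC.ext_of_counit_mul fun d ↦ by
    rw [K.duality, ← mul_assoc, ← mul_assoc, K.duality, map_mul K.ι]

/-- The closed window `W = ιStar ∘ ι` and the genus-one operator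
`H = m_C ∘ Δ_C` of a knowledgeable Frobenius algebra can be moved around
freely: `W` commutes with multiplications, comultiplications, and with `H`. -/
theorem closed_window_moves_freely
    (k A C : Type*) [Field k] [Ring A] [Algebra k A] [CommRing C] [Algebra k C]
    (K : KnowledgeableFrobenius k A C) :
    (∀ c c' : C, K.ιStar (K.ι (c * c')) = K.ιStar (K.ι c) * c') ∧
    (∀ c c' : C, K.ιStar (K.ι (c * c')) = c * K.ιStar (K.ι c')) ∧
    (∀ c : C, K.FC.Δ (K.ιStar (K.ι c)) =
      ((K.ιStar ∘ₗ K.ι.toLinearMap).rTensor C) (K.FC.Δ c)) ∧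
    (∀ c : C, K.FC.Δ (K.ιStar (K.ι c)) =
      ((K.ιStar ∘ₗ K.ι.toLinearMap).lTensor C) (K.FC.Δ c)) ∧
    (∀ c : C, K.ιStar (K.ι (LinearMap.mul' k C (K.FC.Δ c))) =
      LinearMap.mul' k C (K.FC.Δ (K.ιStar (K.ι c)))) := by
  have hmul (c c' : C) : K.ιStar (K.ι (c * c')) = c * K.ιStar (K.ι c') := by
    rw [map_mul, K.ιStar_ι_mul]
  have hmul' (c c' : C) : K.ιStar (K.ι (c * c')) = K.ιStar (K.ι c) * c' := by
    rw [mul_comm c, hmul, mul_comm]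
  have hone (c : C) : K.ιStar (K.ι c) = c * K.ιStar (K.ι 1) := by
    rw [← hmul, mul_one]
  refine ⟨hmul', hmul, fun c ↦ ?_, fun c ↦ ?_, fun c ↦ ?_⟩
  · rw [hone, mul_comm, K.FC.frob_right]
    induction K.FC.Δ c with
    | zero => simp
    | tmul a b => simp [hone a, mul_comm a]
    | add s t hs ht => simp only [mul_add, map_add, hs, ht]
  · rw [hone, K.FC.frob_left]
    induction K.FC.Δ c with
    | zero => simp
    | tmul a b => simp [hone b]
    | add s t hs ht => simp only [add_mul, map_add, hs, ht]
  · rw [hone, hone c, K.FC.frob_left]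
    induction K.FC.Δ c with
    | zero => simp
    | tmul a b => simp [mul_assoc]
    | add s t hs ht => simp only [add_mul, map_add, hs, ht]
end

section
/- Let (A, C, ι, ι*) and (A', C', ι', ι'*) be knowledgeable Frobenius algebras over a field k. Equip A ⊗[k] A' with its tensor-product algebra structure, with comultiplication Δ := (id_A ⊗ σ_{A,A'} ⊗ id_{A'}) ∘ (Δ_A ⊗ Δ_{A'}) (where σ_{A,A'} swaps the middle two tensor factors) and counit ε_A ⊗ ε_{A'}; equip C ⊗[k] C' analogously. Then (A ⊗ A', Δ, ε_A ⊗ ε_{A'}) is a symmetric Frobenius algebra, (C ⊗ C', Δ_{C⊗C'}, ε_C ⊗ ε_{C'}) is a commutative Frobenius algebra, ι ⊗ ι' : C ⊗ C' → A ⊗ A' is a k-algebra homomorphism, and the quadruple (A ⊗ A', C ⊗ C', ι ⊗ ι', ι* ⊗ ι'*) satisfies the knowledge, duality, and Cardy conditions; i.e., it is a knowledgeable Frobenius algebra over k. -/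
open TensorProduct

namespace FrobeniusData

variable {k A A' : Type*} [Field k] [Ring A] [Algebra k A] [Ring A'] [Algebra k A']

/-- The tensor product of comultiplications, with the middle factors swapped. -/
def tensorComul (Δ : A →ₗ[k] A ⊗[k] A) (Δ' : A' →ₗ[k] A' ⊗[k] A') :
    A ⊗[k] A' →ₗ[k] (A ⊗[k] A') ⊗[k] (A ⊗[k] A') :=
  (TensorProduct.tensorTensorTensorComm k A A A' A').toLinearMap ∘ₗ TensorProduct.map Δ Δ'

/-- The tensor product of counits. -/
def tensorCounit (ε : A →ₗ[k] k) (ε' : A' →ₗ[k] k) : A ⊗[k] A' →ₗ[k] k :=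
  (TensorProduct.lid k k).toLinearMap ∘ₗ TensorProduct.map ε ε'

@[simp]
theorem tensorComul_tmul (Δ : A →ₗ[k] A ⊗[k] A) (Δ' : A' →ₗ[k] A' ⊗[k] A') (a : A) (a' : A') :
    tensorComul Δ Δ' (a ⊗ₜ a') =
      TensorProduct.tensorTensorTensorComm k A A A' A' (Δ a ⊗ₜ Δ' a') := rfl

@[simp]
theorem tensorCounit_tmul (ε : A →ₗ[k] k) (ε' : A' →ₗ[k] k) (a : A) (a' : A') :
    tensorCounit ε ε' (a ⊗ₜ a') = ε a * ε' a' := rfl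

theorem assoc_tensorTensorTensorComm_tmul (x : A ⊗[k] A) (y : A' ⊗[k] A') (q : A) (q' : A') :
    TensorProduct.assoc k (A ⊗[k] A') (A ⊗[k] A') (A ⊗[k] A')
        (TensorProduct.tensorTensorTensorComm k A A A' A' (x ⊗ₜ y) ⊗ₜ (q ⊗ₜ q')) =
      (TensorProduct.tensorTensorTensorComm k A A A' A').toLinearMap.lTensor (A ⊗[k] A')
        (TensorProduct.tensorTensorTensorComm k A (A ⊗[k] A) A' (A' ⊗[k] A')
          (TensorProduct.assoc k A A A (x ⊗ₜ q) ⊗ₜ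
            TensorProduct.assoc k A' A' A' (y ⊗ₜ q'))) := by
  induction x with
  | zero => simp
  | add x₁ x₂ h₁ h₂ => simp only [add_tmul, map_add, h₁, h₂]
  | tmul p r =>
    induction y with
    | zero => simp
    | add y₁ y₂ h₁ h₂ => simp only [add_tmul, tmul_add, map_add, h₁, h₂]
    | tmul p' r' => simp

theorem assoc_rTensor_tensorComul (Δ : A →ₗ[k] A ⊗[k] A) (Δ' : A' →ₗ[k] A' ⊗[k] A')
    (x : A ⊗[k] A) (y : A' ⊗[k] A') :
    TensorProduct.assoc k (A ⊗[k] A') (A ⊗[k] A') (A ⊗[k] A')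
        ((tensorComul Δ Δ').rTensor (A ⊗[k] A')
          (TensorProduct.tensorTensorTensorComm k A A A' A' (x ⊗ₜ y))) =
      (TensorProduct.tensorTensorTensorComm k A A A' A').toLinearMap.lTensor (A ⊗[k] A')
        (TensorProduct.tensorTensorTensorComm k A (A ⊗[k] A) A' (A' ⊗[k] A')
          (TensorProduct.assoc k A A A (Δ.rTensor A x) ⊗ₜ
            TensorProduct.assoc k A' A' A' (Δ'.rTensor A' y))) := by
  induction x with
  | zero => simp
  | add x₁ x₂ h₁ h₂ => simp only [add_tmul, map_add, h₁, h₂]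
  | tmul p q =>
    induction y with
    | zero => simp
    | add y₁ y₂ h₁ h₂ => simp only [tmul_add, map_add, h₁, h₂]
    | tmul p' q' =>
      simp only [tensorTensorTensorComm_tmul, LinearMap.rTensor_tmul, tensorComul_tmul,
        assoc_tensorTensorTensorComm_tmul]

theorem lTensor_tensorComul (Δ : A →ₗ[k] A ⊗[k] A) (Δ' : A' →ₗ[k] A' ⊗[k] A')
    (x : A ⊗[k] A) (y : A' ⊗[k] A') :
    (tensorComul Δ Δ').lTensor (A ⊗[k] A')
        (TensorProduct.tensorTensorTensorComm k A A A' A' (x ⊗ₜ y)) =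
      (TensorProduct.tensorTensorTensorComm k A A A' A').toLinearMap.lTensor (A ⊗[k] A')
        (TensorProduct.tensorTensorTensorComm k A (A ⊗[k] A) A' (A' ⊗[k] A')
          (Δ.lTensor A x ⊗ₜ Δ'.lTensor A' y)) := by
  induction x with
  | zero => simp only [zero_tmul, LinearEquiv.map_zero, LinearMap.map_zero]
  | add x₁ x₂ h₁ h₂ => simp only [add_tmul, map_add, h₁, h₂]
  | tmul p q =>
    induction y with
    | zero => simp only [tmul_zero, LinearEquiv.map_zero, LinearMap.map_zero]
    | add y₁ y₂ h₁ h₂ => simp only [tmul_add, map_add, h₁, h₂]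
    | tmul p' q' => simp

theorem lid_rTensor_tensorCounit (ε : A →ₗ[k] k) (ε' : A' →ₗ[k] k)
    (x : A ⊗[k] A) (y : A' ⊗[k] A') :
    TensorProduct.lid k (A ⊗[k] A') ((tensorCounit ε ε').rTensor (A ⊗[k] A')
        (TensorProduct.tensorTensorTensorComm k A A A' A' (x ⊗ₜ y))) =
      TensorProduct.lid k A (ε.rTensor A x) ⊗ₜ TensorProduct.lid k A' (ε'.rTensor A' y) := by
  induction x with
  | zero => simp
  | add x₁ x₂ h₁ h₂ => simp only [add_tmul, map_add, h₁, h₂]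
  | tmul p q =>
    induction y with
    | zero => simp
    | add y₁ y₂ h₁ h₂ => simp only [tmul_add, map_add, h₁, h₂]
    | tmul p' q' => simp [← smul_tmul', smul_smul, mul_comm]

theorem rid_lTensor_tensorCounit (ε : A →ₗ[k] k) (ε' : A' →ₗ[k] k)
    (x : A ⊗[k] A) (y : A' ⊗[k] A') :
    TensorProduct.rid k (A ⊗[k] A') ((tensorCounit ε ε').lTensor (A ⊗[k] A')
        (TensorProduct.tensorTensorTensorComm k A A A' A' (x ⊗ₜ y))) =
      TensorProduct.rid k A (ε.lTensor A x) ⊗ₜ TensorProduct.rid k A' (ε'.lTensor A' y) := by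
  induction x with
  | zero => simp
  | add x₁ x₂ h₁ h₂ => simp only [add_tmul, map_add, h₁, h₂]
  | tmul p q =>
    induction y with
    | zero => simp
    | add y₁ y₂ h₁ h₂ => simp only [tmul_add, map_add, h₁, h₂]
    | tmul p' q' => simp [← smul_tmul', smul_smul, mul_comm]

theorem tensorTensorTensorComm_mul (x₁ x₂ : A ⊗[k] A) (y₁ y₂ : A' ⊗[k] A') :
    TensorProduct.tensorTensorTensorComm k A A A' A' ((x₁ * x₂) ⊗ₜ (y₁ * y₂)) =
      TensorProduct.tensorTensorTensorComm k A A A' A' (x₁ ⊗ₜ y₁) *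
        TensorProduct.tensorTensorTensorComm k A A A' A' (x₂ ⊗ₜ y₂) := by
  rw [← Algebra.TensorProduct.tmul_mul_tmul]
  exact map_mul (Algebra.TensorProduct.tensorTensorTensorComm k k k k A A A' A') _ _

theorem mul'_comm_tensorTensorTensorComm (x : A ⊗[k] A) (y : A' ⊗[k] A') :
    LinearMap.mul' k (A ⊗[k] A') (TensorProduct.comm k (A ⊗[k] A') (A ⊗[k] A')
        (TensorProduct.tensorTensorTensorComm k A A A' A' (x ⊗ₜ y))) =
      LinearMap.mul' k A (TensorProduct.comm k A A x) ⊗ₜ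
        LinearMap.mul' k A' (TensorProduct.comm k A' A' y) := by
  induction x with
  | zero => simp
  | add x₁ x₂ h₁ h₂ => simp only [add_tmul, map_add, h₁, h₂]
  | tmul p q =>
    induction y with
    | zero => simp
    | add y₁ y₂ h₁ h₂ => simp only [tmul_add, map_add, h₁, h₂]
    | tmul p' q' => simp

/-- The tensor product of two Frobenius algebras. -/
def tensorProduct (F : FrobeniusData k A) (F' : FrobeniusData k A') :
    FrobeniusData k (A ⊗[k] A') where
  Δ := tensorComul F.Δ F'.Δ
  ε := tensorCounit F.ε F'.ε
  coassoc a := by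
    induction a with
    | zero => simp
    | add a b ha hb => simp only [map_add, ha, hb]
    | tmul a a' =>
      rw [tensorComul_tmul, assoc_rTensor_tensorComul, lTensor_tensorComul, F.coassoc,
        F'.coassoc]
  counit_left a := by
    induction a with
    | zero => simp
    | add a b ha hb => simp only [map_add, ha, hb]
    | tmul a a' =>
      rw [tensorComul_tmul, lid_rTensor_tensorCounit, F.counit_left, F'.counit_left]
  counit_right a := by
    induction a with
    | zero => simp
    | add a b ha hb => simp only [map_add, ha, hb]
    | tmul a a' =>
      rw [tensorComul_tmul, rid_lTensor_tensorCounit, F.counit_right, F'.counit_right]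
  frob_left a b := by
    induction a with
    | zero => simp
    | add a₁ a₂ h₁ h₂ => simp only [add_mul, map_add, h₁, h₂]
    | tmul a a' =>
      induction b with
      | zero => simp
      | add b₁ b₂ h₁ h₂ => simp only [mul_add, tmul_add, map_add, h₁, h₂]
      | tmul b b' =>
        rw [Algebra.TensorProduct.tmul_mul_tmul, tensorComul_tmul, F.frob_left, F'.frob_left,
          tensorTensorTensorComm_mul, tensorTensorTensorComm_tmul, tensorComul_tmul,
          Algebra.TensorProduct.one_def]
  frob_right a b := by
    induction a with
    | zero => simp
    | add a₁ a₂ h₁ h₂ => simp only [add_mul, add_tmul, map_add, h₁, h₂]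
    | tmul a a' =>
      induction b with
      | zero => simp
      | add b₁ b₂ h₁ h₂ => simp only [mul_add, map_add, h₁, h₂]
      | tmul b b' =>
        rw [Algebra.TensorProduct.tmul_mul_tmul, tensorComul_tmul, F.frob_right, F'.frob_right,
          tensorTensorTensorComm_mul, tensorTensorTensorComm_tmul, tensorComul_tmul,
          Algebra.TensorProduct.one_def]

end FrobeniusData

namespace KnowledgeableFrobenius

variable {k A C A' C' : Type*} [Field k]
  [Ring A] [Algebra k A] [CommRing C] [Algebra k C]
  [Ring A'] [Algebra k A'] [CommRing C'] [Algebra k C']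

/-- The tensor product of two knowledgeable Frobenius algebras. -/
def tensorProduct (K : KnowledgeableFrobenius k A C) (K' : KnowledgeableFrobenius k A' C') :
    KnowledgeableFrobenius k (A ⊗[k] A') (C ⊗[k] C') where
  FA := K.FA.tensorProduct K'.FA
  FC := K.FC.tensorProduct K'.FC
  symmA a b := by
    induction a with
    | zero => simp
    | add a₁ a₂ h₁ h₂ => simp only [add_mul, mul_add, map_add, h₁, h₂]
    | tmul a a' =>
      induction b with
      | zero => simp
      | add b₁ b₂ h₁ h₂ => simp only [add_mul, mul_add, map_add, h₁, h₂]
      | tmul b b' =>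
        simp [FrobeniusData.tensorProduct, K.symmA a b, K'.symmA a' b']
  ι := Algebra.TensorProduct.map K.ι K'.ι
  ιStar := TensorProduct.map K.ιStar K'.ιStar
  knowledge a c := by
    induction a with
    | zero => simp
    | add a₁ a₂ h₁ h₂ => simp only [add_mul, mul_add, h₁, h₂]
    | tmul a a' =>
      induction c with
      | zero => simp
      | add c₁ c₂ h₁ h₂ => simp only [add_mul, mul_add, map_add, h₁, h₂]
      | tmul c c' => simp [K.knowledge, K'.knowledge]
  duality a c := by
    induction a with
    | zero => simp
    | add a₁ a₂ h₁ h₂ => simp only [mul_add, map_add, h₁, h₂]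
    | tmul a a' =>
      induction c with
      | zero => simp
      | add c₁ c₂ h₁ h₂ => simp only [add_mul, map_add, h₁, h₂]
      | tmul c c' => simp [FrobeniusData.tensorProduct, K.duality, K'.duality]
  cardy a := by
    induction a with
    | zero => simp
    | add a₁ a₂ h₁ h₂ => simp only [map_add, h₁, h₂]
    | tmul a a' =>
      simp [FrobeniusData.tensorProduct, FrobeniusData.mul'_comm_tensorTensorTensorComm,
        K.cardy, K'.cardy]

end KnowledgeableFrobenius

/-- The tensor product of two knowledgeable Frobenius algebras is again a
knowledgeable Frobenius algebra, with comultiplication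
`(id ⊗ σ ⊗ id) ∘ (Δ ⊗ Δ')`, counit `ε ⊗ ε'`, algebra map `ι ⊗ ι'` and
dual map `ιStar ⊗ ιStar'`. -/
theorem knowledgeable_tensorProduct
    (k A C A' C' : Type*) [Field k]
    [Ring A] [Algebra k A] [CommRing C] [Algebra k C]
    [Ring A'] [Algebra k A'] [CommRing C'] [Algebra k C']
    (K : KnowledgeableFrobenius k A C) (K' : KnowledgeableFrobenius k A' C') :
    ∃ KT : KnowledgeableFrobenius k (A ⊗[k] A') (C ⊗[k] C'),
      KT.FA.Δ = (TensorProduct.tensorTensorTensorComm k A A A' A').toLinearMap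
          ∘ₗ TensorProduct.map K.FA.Δ K'.FA.Δ ∧
      KT.FA.ε = (TensorProduct.lid k k).toLinearMap
          ∘ₗ TensorProduct.map K.FA.ε K'.FA.ε ∧
      KT.FC.Δ = (TensorProduct.tensorTensorTensorComm k C C C' C').toLinearMap
          ∘ₗ TensorProduct.map K.FC.Δ K'.FC.Δ ∧
      KT.FC.ε = (TensorProduct.lid k k).toLinearMap
          ∘ₗ TensorProduct.map K.FC.ε K'.FC.ε ∧
      KT.ι = Algebra.TensorProduct.map K.ι K'.ι ∧
      KT.ιStar = TensorProduct.map K.ιStar K'.ιStar := by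
  exact ⟨K.tensorProduct K', rfl, rfl, rfl, rfl, rfl, rfl⟩
end

section
/- Let k be a field, S a set, and suppose given for all a, b, c, d ∈ S: k-vector spaces A_{ab}; k-linear maps μ_{abc} : A_{ab} ⊗[k] A_{bc} → A_{ac}; elements η_a ∈ A_{aa}; k-linear maps Δ_{abc} : A_{ac} → A_{ab} ⊗[k] A_{bc}; and ε_a : A_{aa} → k, satisfying: associativity μ_{abd} ∘ (id ⊗ μ_{bcd}) = μ_{acd} ∘ (μ_{abc} ⊗ id) (after the canonical reassociation of tensor factors); unit laws μ_{aab}(η_a ⊗ x) = x and μ_{abb}(x ⊗ η_b) = x for all x ∈ A_{ab}; coassociativity (Δ_{abc} ⊗ id) ∘ Δ_{acd} = (id ⊗ Δ_{bcd}) ∘ Δ_{abd} (after reassociation); counit laws (ε_a ⊗ id) ∘ Δ_{aab} = id and (id ⊗ ε_b) ∘ Δ_{abb} = id (after the canonical unitor identifications); the Frobenius relations Δ_{abd} ∘ μ_{acd} = (id ⊗ μ_{bcd}) ∘ (Δ_{abc} ⊗ id) = (μ_{abc} ⊗ id) ∘ (id ⊗ Δ_{bcd}) (after reassociation); and symmetry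 ε_a(μ_{aba}(x ⊗ y)) = ε_b(μ_{bab}(y ⊗ x)) for all x ∈ A_{ab}, y ∈ A_{ba}. Then for all a, b ∈ S, the space A_{ab} is finite-dimensional over k and the bilinear pairing A_{ab} × A_{ba} → k, (x, y) ↦ ε_a(μ_{aba}(x ⊗ y)), is nondegenerate (so A_{ba} is a dual of A_{ab}). -/
open TensorProduct

/-- S-coloured analogue of rigidity: given a family of spaces `A a b` with
multiplications `μ`, units `η`, comultiplications `Δ` and counits `ε`
satisfying the associativity, unit, coassociativity, counit, Frobenius and
symmetry axioms, each `A a b` is finite-dimensional and the pairing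
`(x, y) ↦ ε a (μ a b a (x ⊗ y))` between `A a b` and `A b a` is
nondegenerate. -/
theorem coloured_frobenius_rigid
    (k : Type*) [Field k] (S : Type*)
    (A : S → S → Type*)
    [∀ a b, AddCommGroup (A a b)] [∀ a b, Module k (A a b)]
    (μ : ∀ a b c, A a b ⊗[k] A b c →ₗ[k] A a c)
    (η : ∀ a, A a a)
    (Δ : ∀ a b c, A a c →ₗ[k] A a b ⊗[k] A b c)
    (ε : ∀ a, A a a →ₗ[k] k)
    (assoc : ∀ (a b c d : S) (x : A a b) (y : A b c) (z : A c d),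
      μ a b d (x ⊗ₜ[k] μ b c d (y ⊗ₜ[k] z)) =
        μ a c d (μ a b c (x ⊗ₜ[k] y) ⊗ₜ[k] z))
    (unit_left : ∀ (a b : S) (x : A a b), μ a a b (η a ⊗ₜ[k] x) = x)
    (unit_right : ∀ (a b : S) (x : A a b), μ a b b (x ⊗ₜ[k] η b) = x)
    (coassoc : ∀ (a b c d : S) (x : A a d),
      (TensorProduct.assoc k (A a b) (A b c) (A c d))
          (((Δ a b c).rTensor (A c d)) ((Δ a c d) x)) =
        ((Δ b c d).lTensor (A a b)) ((Δ a b d) x))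
    (counit_left : ∀ (a b : S) (x : A a b),
      (TensorProduct.lid k (A a b)) (((ε a).rTensor (A a b)) ((Δ a a b) x)) = x)
    (counit_right : ∀ (a b : S) (x : A a b),
      (TensorProduct.rid k (A a b)) (((ε b).lTensor (A a b)) ((Δ a b b) x)) = x)
    (frob_left : ∀ (a b c d : S) (x : A a c) (z : A c d),
      Δ a b d (μ a c d (x ⊗ₜ[k] z)) =
        ((μ b c d).lTensor (A a b))
          ((TensorProduct.assoc k (A a b) (A b c) (A c d))
            ((Δ a b c x) ⊗ₜ[k] z)))
    (frob_right : ∀ (a b c d : S) (x : A a b) (z : A b d),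
      Δ a c d (μ a b d (x ⊗ₜ[k] z)) =
        ((μ a b c).rTensor (A c d))
          ((TensorProduct.assoc k (A a b) (A b c) (A c d)).symm
            (x ⊗ₜ[k] (Δ b c d z))))
    (symm : ∀ (a b : S) (x : A a b) (y : A b a),
      ε a (μ a b a (x ⊗ₜ[k] y)) = ε b (μ b a b (y ⊗ₜ[k] x))) :
    ∀ a b : S,
      FiniteDimensional k (A a b) ∧
      (∀ x : A a b, (∀ y : A b a, ε a (μ a b a (x ⊗ₜ[k] y)) = 0) → x = 0) ∧
      (∀ y : A b a, (∀ x : A a b, ε a (μ a b a (x ⊗ₜ[k] y)) = 0) → y = 0) := by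
  have expand : ∀ a b : S, ∃ s : Finset (A b a × A a b), ∀ x : A a b,
      x = ∑ i ∈ s, ε a (μ a b a (x ⊗ₜ[k] i.1)) • i.2 := by
    intro a b
    obtain ⟨s, hs⟩ := TensorProduct.exists_finset (Δ b a b (η b))
    refine ⟨s, fun x => ?_⟩
    have h := counit_left a b x
    have hΔ := frob_right a b a b x (η b)
    rw [unit_right, hs] at hΔ
    rw [hΔ] at h
    simpa [TensorProduct.tmul_sum, map_sum] using h.symm
  have nondegenerate_left : ∀ (a b : S) (x : A a b),
      (∀ y : A b a, ε a (μ a b a (x ⊗ₜ[k] y)) = 0) → x = 0 := by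
    intro a b x hx
    obtain ⟨s, hs⟩ := expand a b
    rw [hs x]
    simp [hx]
  intro a b
  refine ⟨?_, nondegenerate_left a b, fun y hy =>
    nondegenerate_left b a y fun x => (symm a b x y).symm.trans (hy x)⟩
  classical
  obtain ⟨s, hs⟩ := expand a b
  refine ⟨⟨s.image Prod.snd, eq_top_iff.2 fun x _ => ?_⟩⟩
  rw [hs x]
  exact Submodule.sum_mem _ fun i hi => Submodule.smul_mem _ _
    (Submodule.subset_span (Finset.mem_image_of_mem _ hi))
end
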